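/- For every horizon T ≥ 0, the finite-horizon value function ω ↦ V_T(ω) is a convex function on [0,1]. -/

import Mathlib

/-- One-step belief update without observation: `T(ω) = ω·p11 + (1−ω)·p01`. -/
noncomputable def Tmap (p01 p11 ω : ℝ) : ℝ := ω * p11 + (1 - ω) * p01

/-- Belief update after a failed observation: `φ(ω) = εω/(εω + 1 − ω)`. -/
noncomputable def phi (ε ω : ℝ) : ℝ := ε * ω / (ε * ω + 1 - ω)

/-- Finite-horizon value function `V_T` of the single-armed bandit with subsidy `m`:
`V_0 ≡ 0` and `V_T(ω) = max{V_T(ω;u=1), V_T(ω;u=0)}`. -/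
noncomputable def Vfin (p01 p11 ε β m : ℝ) : ℕ → ℝ → ℝ
  | 0, _ => 0
  | T + 1, ω =>
      max ((1 - ε) * ω + β * ((1 - ε) * ω * Vfin p01 p11 ε β m T p11
            + (1 - (1 - ε) * ω) * Vfin p01 p11 ε β m T (Tmap p01 p11 (phi ε ω))))
          (m + β * Vfin p01 p11 ε β m T (Tmap p01 p11 ω))


theorem Tmap_mem_Icc {p01 p11 ω : ℝ} (hp01 : p01 ∈ Set.Icc (0:ℝ) 1)
    (hp11 : p11 ∈ Set.Icc (0:ℝ) 1) (hω : ω ∈ Set.Icc (0:ℝ) 1) :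
    Tmap p01 p11 ω ∈ Set.Icc (0:ℝ) 1 :=
  convex_Icc (0:ℝ) 1 hp11 hp01 hω.1 (sub_nonneg.2 hω.2) (by ring)

/-- Precomposition with the affine map `Tmap` preserves convexity on `[0,1]`. -/
theorem ConvexOn.comp_Tmap {p01 p11 : ℝ} {f : ℝ → ℝ} (hf : ConvexOn ℝ (Set.Icc (0:ℝ) 1) f)
    (hp01 : p01 ∈ Set.Icc (0:ℝ) 1) (hp11 : p11 ∈ Set.Icc (0:ℝ) 1) :
    ConvexOn ℝ (Set.Icc (0:ℝ) 1) fun ω => f (Tmap p01 p11 ω) := by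
  refine ⟨convex_Icc 0 1, fun x hx y hy a b ha hb hab => ?_⟩
  have key : Tmap p01 p11 (a • x + b • y) = a • Tmap p01 p11 x + b • Tmap p01 p11 y := by
    simp only [Tmap, smul_eq_mul]
    linear_combination (-p01) * hab
  simpa only [key] using
    hf.2 (Tmap_mem_Icc hp01 hp11 hx) (Tmap_mem_Icc hp01 hp11 hy) ha hb hab

theorem one_sub_one_sub_mul_pos {ε ω : ℝ} (hε : 0 < ε) (hω : ω ∈ Set.Icc (0:ℝ) 1) :
    0 < 1 - (1 - ε) * ω := by
  rcases hω.2.lt_or_eq with h | rfl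
  · nlinarith [mul_nonneg hε.le hω.1]
  · linarith

theorem phi_eq_div (ε ω : ℝ) : phi ε ω = ε * ω / (1 - (1 - ε) * ω) := by
  rw [phi]
  ring_nf

theorem phi_mem_Icc {ε ω : ℝ} (hε : 0 < ε) (hω : ω ∈ Set.Icc (0:ℝ) 1) :
    phi ε ω ∈ Set.Icc (0:ℝ) 1 := by
  have hd := one_sub_one_sub_mul_pos hε hω
  rw [phi_eq_div]
  exact ⟨div_nonneg (mul_nonneg hε.le hω.1) hd.le, (div_le_one hd).2 (by linarith [hω.2])⟩

/-- The perspective transform of a convex function along the Bayes update `phi` is convex. -/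
theorem ConvexOn.mul_comp_phi {ε : ℝ} {f : ℝ → ℝ} (hf : ConvexOn ℝ (Set.Icc (0:ℝ) 1) f)
    (hε : 0 < ε) :
    ConvexOn ℝ (Set.Icc (0:ℝ) 1) fun ω => (1 - (1 - ε) * ω) * f (phi ε ω) := by
  refine ⟨convex_Icc 0 1, fun x hx y hy a b ha hb hab => ?_⟩
  have hdx := one_sub_one_sub_mul_pos hε hx
  have hdy := one_sub_one_sub_mul_pos hε hy
  have hd := one_sub_one_sub_mul_pos hε (convex_Icc (0:ℝ) 1 hx hy ha hb hab)
  have hx' := phi_mem_Icc hε hx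
  have hy' := phi_mem_Icc hε hy
  have hphi := phi_eq_div ε (a • x + b • y)
  have hnx : (1 - (1 - ε) * x) * phi ε x = ε * x := by
    rw [phi_eq_div, mul_div_cancel₀ _ hdx.ne']
  have hny : (1 - (1 - ε) * y) * phi ε y = ε * y := by
    rw [phi_eq_div, mul_div_cancel₀ _ hdy.ne']
  have hsum : 1 - (1 - ε) * (a • x + b • y)
      = a * (1 - (1 - ε) * x) + b * (1 - (1 - ε) * y) := by
    simp only [smul_eq_mul]
    linear_combination -hab
  simp only [smul_eq_mul] at *
  set dx := 1 - (1 - ε) * x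
  set dy := 1 - (1 - ε) * y
  set d := 1 - (1 - ε) * (a * x + b * y)
  have hcomb : phi ε (a * x + b * y) = a * dx / d * phi ε x + b * dy / d * phi ε y := by
    rw [hphi]
    field_simp
    linear_combination (-a) * hnx - b * hny
  have hconv := hf.2 hx' hy' (show 0 ≤ a * dx / d by positivity)
    (show 0 ≤ b * dy / d by positivity) (by rw [← add_div, ← hsum, div_self hd.ne'])
  simp only [smul_eq_mul] at hconv
  rw [← hcomb] at hconv
  calc d * f (phi ε (a * x + b * y))
      ≤ d * (a * dx / d * f (phi ε x) + b * dy / d * f (phi ε y)) :=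
        mul_le_mul_of_nonneg_left hconv hd.le
    _ = a * (dx * f (phi ε x)) + b * (dy * f (phi ε y)) := by
        field_simp

/-- Every finite-horizon value function `V_T` is convex on `[0,1]`. -/
theorem Vfin_convexOn (p01 p11 ε β m : ℝ)
    (hp01 : p01 ∈ Set.Ioo (0:ℝ) 1) (hp11 : p11 ∈ Set.Ioo (0:ℝ) 1)
    (hne : p01 ≠ p11) (hε : ε ∈ Set.Ioo (0:ℝ) 1) (hβ : β ∈ Set.Ioo (0:ℝ) 1) :
    ∀ T : ℕ, ConvexOn ℝ (Set.Icc (0:ℝ) 1) (Vfin p01 p11 ε β m T) := by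
  have hp01' := Set.Ioo_subset_Icc_self hp01
  have hp11' := Set.Ioo_subset_Icc_self hp11
  intro T
  induction T with
  | zero => exact convexOn_const 0 (convex_Icc 0 1)
  | succ T ih =>
    have hV := ih.comp_Tmap hp01' hp11'
    have hlin : ConvexOn ℝ (Set.Icc (0:ℝ) 1)
        fun ω => (1 - ε + β * (1 - ε) * Vfin p01 p11 ε β m T p11) * ω :=
      (LinearMap.mulLeft ℝ _).convexOn (convex_Icc 0 1)
    have hactive := hlin.add ((hV.mul_comp_phi hε.1).smul hβ.1.le)
    have hpassive := (convexOn_const m (convex_Icc (0:ℝ) 1)).add (hV.smul hβ.1.le)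
    refine (hactive.sup hpassive).congr fun ω _ => ?_
    simp only [Pi.sup_apply, Pi.add_apply, smul_eq_mul, Vfin]
    congr 1
    ring
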